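/- arXiv:1402.0834 — 2 statements merged into one kernel-verified Lean document; each statement's English description precedes it below -/
import Mathlib

section
/- Let d ≥ 2 and r ≥ 1, and let E₀ : Set(ℤ^d) → Set(ℤ^d) be a function satisfying: (locality) E₀(ω) = E₀(ω') whenever ω ∩ B^∞_r = ω' ∩ B^∞_r; and (range) E₀(ω) ⊆ B^∞_r for every ω. Suppose E₀ is essential: there exists a configuration ω' ⊆ ℤ^d containing no doubly infinite path, such that ω' ∪ E₀(ω') does contain a doubly infinite path. Then there exist an integer m > r and a finite configuration ω ⊆ B^∞_m such that: ω ∩ S^∞_m = {e_m, −e_m}; ω contains no path joining −e_m to e_m; and ω ∪ E₀(ω) does contain a path joining −e_m to e_m. -/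
/-- The `ℓ1`-norm of a point of `ℤ^d`. -/
def norm1 {d : ℕ} (x : Fin d → ℤ) : ℤ := ∑ i, |x i|

/-- Grid adjacency in `ℤ^d`: `u` and `v` are adjacent iff `‖u - v‖₁ = 1`. -/
def Adj {d : ℕ} (u v : Fin d → ℤ) : Prop := norm1 (u - v) = 1

/-- The `ℓ∞`-ball `B^∞_r = {v : ‖v‖_∞ ≤ r}` in `ℤ^d`. -/
def Binf (d : ℕ) (r : ℤ) : Set (Fin d → ℤ) := {x | ∀ i, |x i| ≤ r}

/-- The `ℓ∞`-sphere `S^∞_r = {v : ‖v‖_∞ = r}` in `ℤ^d`. -/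
def Sinf (d : ℕ) (r : ℤ) : Set (Fin d → ℤ) := {x | (∀ i, |x i| ≤ r) ∧ ∃ i, |x i| = r}

/-- The point `e_m = (m, 0, …, 0)` of `ℤ^d`. -/
def eVec (d : ℕ) (m : ℤ) : Fin d → ℤ := fun i => if (i : ℕ) = 0 then m else 0

/-- `ω` contains a path joining `x` to `y`: a finite sequence of distinct points of `ω`,
starting at `x` and ending at `y`, with consecutive points adjacent. -/
def HasPathJoining {d : ℕ} (ω : Set (Fin d → ℤ)) (x y : Fin d → ℤ) : Prop :=
  ∃ (L : List (Fin d → ℤ)) (h : L ≠ []),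
    L.Nodup ∧ L.Chain' Adj ∧ (∀ z ∈ L, z ∈ ω) ∧ L.head h = x ∧ L.getLast h = y

/-- `ω` contains a doubly infinite path: an injective `f : ℤ → ℤ^d` with `f i ∈ ω`
and `f i` adjacent to `f (i+1)` for every `i`. -/
def HasDoublyInfinitePath {d : ℕ} (ω : Set (Fin d → ℤ)) : Prop :=
  ∃ f : ℤ → Fin d → ℤ, Function.Injective f ∧ ∀ i : ℤ, f i ∈ ω ∧ Adj (f i) (f (i + 1))


/-- Reachability inside a configuration. -/
def Conn {d : ℕ} (S : Set (Fin d → ℤ)) (x y : Fin d → ℤ) : Prop :=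
  Relation.ReflTransGen (fun u v => u ∈ S ∧ v ∈ S ∧ Adj u v) x y

lemma norm1_neg {d : ℕ} (x : Fin d → ℤ) : norm1 (-x) = norm1 x := by
  simp [norm1]

lemma Adj.symm' {d : ℕ} {u v : Fin d → ℤ} (h : Adj u v) : Adj v u := by
  unfold Adj at *
  rw [← neg_sub, norm1_neg]; exact h

lemma abs_le_norm1 {d : ℕ} (x : Fin d → ℤ) (i : Fin d) : |x i| ≤ norm1 x := by
  unfold norm1
  exact Finset.single_le_sum (f := fun i => |x i|) (fun i _ => abs_nonneg _) (Finset.mem_univ i)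

lemma Adj.coord {d : ℕ} {u v : Fin d → ℤ} (h : Adj u v) (i : Fin d) : |u i - v i| ≤ 1 := by
  have := abs_le_norm1 (u - v) i
  unfold Adj at h
  rw [h] at this
  simpa using this

lemma norm1_update {d : ℕ} (w : Fin d → ℤ) (i : Fin d) (c : ℤ) :
    norm1 (Function.update w i c) = norm1 w - |w i| + |c| := by
  unfold norm1
  rw [← Finset.add_sum_erase _ _ (Finset.mem_univ i),
    ← Finset.add_sum_erase (a := i) _ (fun j => |w j|) (Finset.mem_univ i)]
  have : ∑ x ∈ Finset.univ.erase i, |Function.update w i c x|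
      = ∑ x ∈ Finset.univ.erase i, |w x| := by
    apply Finset.sum_congr rfl
    intro x hx
    rw [Function.update_of_ne (Finset.ne_of_mem_erase hx)]
  rw [this]
  simp only [Function.update_self]
  ring

lemma adj_update {d : ℕ} (u : Fin d → ℤ) (i : Fin d) (s : ℤ) (hs : |s| = 1) :
    Adj u (Function.update u i (u i + s)) := by
  unfold Adj
  have : u - Function.update u i (u i + s) = Function.update (0 : Fin d → ℤ) i (-s) := by
    ext j
    by_cases h : j = i
    · subst h; simp
    · simp [h]
  rw [this, norm1_update]
  simp [norm1, hs]

lemma Conn.symm' {d : ℕ} {S : Set (Fin d → ℤ)} {x y} (h : Conn S x y) : Conn S y x := by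
  unfold Conn at *
  induction h with
  | refl => exact .refl
  | tail _ h ih => exact .head ⟨h.2.1, h.1, h.2.2.symm'⟩ ih

lemma Conn.mono' {d : ℕ} {S T : Set (Fin d → ℤ)} (hST : S ⊆ T) {x y} (h : Conn S x y) :
    Conn T x y :=
  Relation.ReflTransGen.mono (fun _ _ h => ⟨hST h.1, hST h.2.1, h.2.2⟩) _ _ h

lemma Conn.trans' {d : ℕ} {S : Set (Fin d → ℤ)} {x y z} (h : Conn S x y) (h' : Conn S y z) :
    Conn S x z := Relation.ReflTransGen.trans h h'

lemma conn_box_aux {d : ℕ} {S : Set (Fin d → ℤ)} : ∀ N : ℕ, ∀ u v : Fin d → ℤ,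
    norm1 (u - v) ≤ N → (∀ z, (∀ i, z i ∈ Set.uIcc (u i) (v i)) → z ∈ S) → Conn S u v := by
  intro N
  induction N with
  | zero =>
    intro u v h _
    have : u = v := by
      ext i
      have := abs_le_norm1 (u - v) i
      have h2 : |(u - v) i| ≤ 0 := by push_cast at h; omega
      simp only [Pi.sub_apply] at h2
      have := abs_nonpos_iff.1 h2
      omega
    subst this; exact .refl
  | succ N ih =>
    intro u v h hS
    by_cases huv : u = v
    · subst huv; exact .refl
    obtain ⟨i, hi⟩ := Function.ne_iff.1 huv
    obtain ⟨s, hs, hs1, hs2⟩ : ∃ s : ℤ, |s| = 1 ∧ |u i + s - v i| = |u i - v i| - 1 ∧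
        u i + s ∈ Set.uIcc (u i) (v i) := by
      rcases lt_or_gt_of_ne hi with h | h
      · refine ⟨1, by simp, ?_, ?_⟩
        · rw [abs_of_nonpos (by omega), abs_of_neg (by omega)]; ring
        · rw [Set.mem_uIcc]; omega
      · refine ⟨-1, by simp, ?_, ?_⟩
        · rw [abs_of_nonneg (by omega), abs_of_pos (by omega)]; ring
        · rw [Set.mem_uIcc]; omega
    set u' := Function.update u i (u i + s) with hu'
    have e : u' - v = Function.update (u - v) i (u i + s - v i) := by
      ext j
      by_cases h : j = i
      · subst h; simp [hu']
      · simp [hu', h]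
    have hn : norm1 (u' - v) ≤ N := by
      rw [e, norm1_update, hs1]
      simp only [Pi.sub_apply]
      push_cast at h
      omega
    have hsub : ∀ j, u' j ∈ Set.uIcc (u j) (v j) := by
      intro j
      by_cases h : j = i
      · subst h; simpa [hu'] using hs2
      · simp [hu', h]
    have := ih u' v hn (fun z hz => hS z (fun j =>
      Set.uIcc_subset_uIcc (hsub j) Set.right_mem_uIcc (hz j)))
    exact .head ⟨hS u (fun j => Set.left_mem_uIcc), hS u' hsub, adj_update u i s hs⟩ this

lemma conn_box {d : ℕ} {S : Set (Fin d → ℤ)} (u v : Fin d → ℤ)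
    (hS : ∀ z, (∀ i, z i ∈ Set.uIcc (u i) (v i)) → z ∈ S) : Conn S u v :=
  conn_box_aux (norm1 (u - v)).toNat u v (Int.self_le_toNat _) hS

/-- The two notions of connection agree on points of the configuration. -/
lemma hasPath_of_conn {d : ℕ} {S : Set (Fin d → ℤ)} {x y : Fin d → ℤ} (hx : x ∈ S)
    (h : Conn S x y) : HasPathJoining S x y := by
  classical
  let G : SimpleGraph (Fin d → ℤ) :=
    { Adj := fun u v => u ∈ S ∧ v ∈ S ∧ Adj u v
      symm := ⟨fun u v h => ⟨h.2.1, h.1, h.2.2.symm'⟩⟩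
      loopless := ⟨fun u h => by simpa [Adj, norm1] using h.2.2⟩ }
  have hr : G.Reachable x y := by
    rw [SimpleGraph.reachable_iff_reflTransGen]; exact h
  obtain ⟨w⟩ := hr
  let p := w.toPath
  refine ⟨p.1.support, by simp, p.2.support_nodup, ?_, ?_, by simp, by simp⟩
  · exact List.IsChain.imp (fun _ _ h => h.2.2) p.1.isChain_adj_support
  · have key : ∀ (a b : Fin d → ℤ) (q : G.Walk a b), a ∈ S → ∀ z ∈ q.support, z ∈ S := by
      intro a b q
      induction q with
      | nil => intro ha z hz; simp at hz; subst hz; exact ha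
      | cons hadj q ih =>
        intro ha z hz
        rw [SimpleGraph.Walk.support_cons, List.mem_cons] at hz
        rcases hz with rfl | hz
        · exact ha
        · exact ih hadj.2.1 z hz
    exact key _ _ p.1 hx

lemma conn_of_hasPath {d : ℕ} {S : Set (Fin d → ℤ)} {x y : Fin d → ℤ}
    (h : HasPathJoining S x y) : Conn S x y := by
  obtain ⟨L, hL, -, hc, hS, rfl, rfl⟩ := h
  induction L with
  | nil => exact absurd rfl hL
  | cons a L ih =>
    cases L with
    | nil => exact .refl
    | cons b L =>
      have hc' : List.IsChain Adj (a :: b :: L) := hc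
      rw [List.isChain_cons_cons] at hc'
      have := ih (by simp) hc'.2 (fun z hz => hS z (List.mem_cons_of_mem _ hz))
      rw [List.getLast_cons (by simp)]
      exact .head ⟨hS a (by simp), hS b (by simp), hc'.1⟩ this

/-- Clamp-free description of a thickened ray leaving the box `Binf d n` at `x`
in direction `σ` along coordinate `k`, a face, and an exit point. -/
def ExtSet {d : ℕ} (n M σ : ℤ) (k : Fin d) (x x' : Fin d → ℤ) : Set (Fin d → ℤ) :=
  {z | z ∉ Binf d n ∧ (∀ i, |z i| ≤ M) ∧ σ * x k ≤ σ * z k ∧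
      ∀ i, i ≠ k → max (-n) (min n (z i)) = x i}
    ∪ {z | (∀ i, |z i| ≤ M) ∧ σ * z k = M} ∪ {x'}

lemma sigma_abs {σ t : ℤ} (hσ : σ = 1 ∨ σ = -1) : |t| = |σ * t| := by
  rcases hσ with rfl | rfl <;> simp

lemma ext_conn {d : ℕ} {n M σ : ℤ} {k : Fin d} {x x' : Fin d → ℤ} (hn : 1 ≤ n) (hM : n + 2 ≤ M)
    (hσ : σ = 1 ∨ σ = -1) (hx : x ∈ Sinf d n) (hxk : -n < σ * x k)
    (hx'k : σ * x' k = M + 1) (hx' : ∀ i, i ≠ k → |x' i| ≤ M) :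
    Conn (ExtSet n M σ k x x' ∪ {x}) x x' := by
  obtain ⟨hxn, i, hi⟩ := hx
  have hclamp : ∀ j, max (-n) (min n (x j)) = x j := by
    intro j; have := abs_le.1 (hxn j); omega
  have hσσ : σ * σ = 1 := by rcases hσ with rfl | rfl <;> simp
  have hMM : |σ * M| = M := by
    rw [← sigma_abs hσ, abs_of_pos (by omega)]
  -- the point after the optional push
  obtain ⟨p, hpk, hpM, hpc, hpx, hpo⟩ : ∃ p : Fin d → ℤ, p k = x k ∧ (∀ j, |p j| ≤ n + 1) ∧
      (∀ j, max (-n) (min n (p j)) = x j) ∧ Conn (ExtSet n M σ k x x' ∪ {x}) x p ∧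
      (p = x ∧ σ * x k = n ∨ ∃ j, j ≠ k ∧ n < |p j|) := by
    by_cases hik : i = k
    · subst hik
      refine ⟨x, rfl, fun j => by have := hxn j; omega, hclamp, .refl, .inl ⟨rfl, ?_⟩⟩
      have h1 := hi
      rw [sigma_abs hσ] at h1
      rcases abs_choice (σ * x i) with h | h <;> omega
    · obtain ⟨s, hs, hs1⟩ : ∃ s : ℤ, |s| = 1 ∧ (s = 1 ∧ x i = n ∨ s = -1 ∧ x i = -n) := by
        rcases abs_choice (x i) with h | h
        · exact ⟨1, by simp, .inl ⟨rfl, by omega⟩⟩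
        · exact ⟨-1, by simp, .inr ⟨rfl, by omega⟩⟩
      have habs : |x i + s| = n + 1 := by
        rcases hs1 with ⟨rfl, h⟩ | ⟨rfl, h⟩
        · rw [h, abs_of_pos] <;> omega
        · rw [h, abs_of_neg] <;> omega
      have hle : ∀ j, |Function.update x i (x i + s) j| ≤ n + 1 := by
        intro j
        by_cases h : j = i
        · subst h; simp [habs]
        · rw [Function.update_of_ne h]; have := hxn j; omega
      have hcl : ∀ j, max (-n) (min n (Function.update x i (x i + s) j)) = x j := by
        intro j
        by_cases h : j = i
        · subst h; rw [Function.update_self]; omega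
        · rw [Function.update_of_ne h]; exact hclamp j
      refine ⟨Function.update x i (x i + s), ?_, hle, hcl, ?_, .inr ⟨i, hik, by simp [habs]⟩⟩
      · rw [Function.update_of_ne (Ne.symm hik)]
      · refine .single ⟨.inr rfl, .inl (.inl (.inl ⟨?_, ?_, ?_, ?_⟩)), adj_update x i s hs⟩
        · intro h
          have := h i
          rw [Function.update_self, habs] at this
          omega
        · intro j; have := hle j; omega
        · rw [Function.update_of_ne (Ne.symm hik)]
        · intro j _; exact hcl j
  refine hpx.trans' ?_
  have hline : Conn (ExtSet n M σ k x x' ∪ {x}) p (Function.update p k (σ * M)) := by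
    apply conn_box
    intro z hz
    have hzj : ∀ j, j ≠ k → z j = p j := by
      intro j hj
      have := hz j
      rw [Function.update_of_ne hj] at this
      simpa using this
    have hzk : σ * x k ≤ σ * z k ∧ σ * z k ≤ M := by
      have := hz k
      rw [Function.update_self, Set.mem_uIcc, hpk] at this
      have h2 := abs_le.1 (hxn k)
      rcases hσ with rfl | rfl <;> omega
    by_cases hzx : z = x
    · exact .inr hzx
    left; left; left
    refine ⟨?_, ?_, hzk.1, ?_⟩
    · intro hB
      rcases hpo with ⟨rfl, hk⟩ | ⟨j, hj, hj'⟩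
      · apply hzx
        ext j
        by_cases hj : j = k
        · subst hj
          have := hB j
          rw [sigma_abs hσ] at this
          have := abs_le.1 this
          rcases hσ with rfl | rfl <;> omega
        · exact hzj j hj
      · have := hB j
        rw [hzj j hj] at this
        omega
    · intro j
      by_cases hj : j = k
      · subst hj
        rw [sigma_abs hσ, abs_le]; omega
      · rw [hzj j hj]; have := hpM j; omega
    · intro j hj
      rw [hzj j hj]; exact hpc j
  refine hline.trans' ?_
  have hface : Conn (ExtSet n M σ k x x' ∪ {x}) (Function.update p k (σ * M))
      (Function.update x' k (σ * M)) := by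
    apply conn_box
    intro z hz
    have hzk : z k = σ * M := by
      have := hz k
      rw [Function.update_self, Function.update_self] at this
      simpa using this
    left; left; right
    refine ⟨?_, ?_⟩
    · intro j
      by_cases hj : j = k
      · subst hj; rw [hzk, hMM]
      · have := hz j
        rw [Function.update_of_ne hj, Function.update_of_ne hj, Set.mem_uIcc] at this
        have h1 := abs_le.1 (hpM j)
        have h2 := abs_le.1 (hx' j hj)
        rw [abs_le]; omega
    · rw [hzk, ← mul_assoc, hσσ, one_mul]
  refine hface.trans' (Relation.ReflTransGen.single ⟨.inl (.inl (.inr ⟨?_, ?_⟩)), .inl (.inr rfl), ?_⟩)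
  · intro j
    by_cases hj : j = k
    · subst hj; rw [Function.update_self, hMM]
    · rw [Function.update_of_ne hj]; exact hx' j hj
  · rw [Function.update_self, ← mul_assoc, hσσ, one_mul]
  · have hh : x' k = σ * M + σ := by
      rcases hσ with rfl | rfl <;> omega
    have : x' = Function.update (Function.update x' k (σ * M)) k
        ((Function.update x' k (σ * M)) k + σ) := by
      rw [Function.update_self, Function.update_idem, ← hh, Function.update_eq_self]
    have h3 := adj_update (Function.update x' k (σ * M)) k σ (by rcases hσ with rfl | rfl <;> simp)
    rw [← this] at h3
    exact h3

lemma norm1_self {d : ℕ} (x : Fin d → ℤ) : norm1 (x - x) = 0 := by simp [norm1]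

lemma sinf_of_adj {d : ℕ} {n : ℤ} {z w : Fin d → ℤ} (hz : z ∈ Binf d n) (hw : w ∉ Binf d n)
    (h : Adj z w) : z ∈ Sinf d n := by
  refine ⟨hz, ?_⟩
  simp only [Binf, Set.mem_ofPred_eq, not_forall, not_le] at hw
  obtain ⟨i, hi⟩ := hw
  refine ⟨i, ?_⟩
  have h1 := h.coord i
  have h2 := hz i
  have h3 := abs_sub_abs_le_abs_sub (w i) (z i)
  rw [abs_sub_comm] at h3
  omega

lemma ext_not_mem {d : ℕ} {n M σ : ℤ} {k : Fin d} {x x' z : Fin d → ℤ} (hM : n + 2 ≤ M)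
    (hσ : σ = 1 ∨ σ = -1) (hx'k : σ * x' k = M + 1) (hz : z ∈ ExtSet n M σ k x x') :
    z ∉ Binf d n := by
  rcases hz with (hz | hz) | rfl
  · exact hz.1
  · intro h
    have h1 := h k
    rw [sigma_abs hσ, hz.2] at h1
    have := le_abs_self M
    omega
  · intro h
    have h1 := h k
    rw [sigma_abs hσ, hx'k] at h1
    have := le_abs_self (M + 1)
    omega

lemma ext_bound {d : ℕ} {n M σ : ℤ} {k : Fin d} {x x' z : Fin d → ℤ}
    (hz : z ∈ ExtSet n M σ k x x') : z ∈ Binf d M ∨ z = x' := by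
  rcases hz with (hz | hz) | hz
  · exact .inl hz.2.1
  · exact .inl hz.1
  · exact .inr hz

/-- Members of the extension are either in the thickened ray or far out. -/
lemma ext_cases {d : ℕ} {n M σ : ℤ} {k : Fin d} {x x' z : Fin d → ℤ} (hx : x ∈ Binf d n)
    (hx'k : σ * x' k = M + 1) (hz : z ∈ ExtSet n M σ k x x' ∪ {x}) :
    (σ * x k ≤ σ * z k ∧ ∀ i, i ≠ k → max (-n) (min n (z i)) = x i) ∨ M ≤ σ * z k := by
  rcases hz with ((hz | hz) | rfl) | rfl
  · exact .inl hz.2.2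
  · exact .inr hz.2.ge
  · right; omega
  · left; refine ⟨le_rfl, fun i _ => ?_⟩
    have := abs_le.1 (hx i); omega

lemma ext_dist {d : ℕ} {n M : ℤ} {k : Fin d} {x y x' y' : Fin d → ℤ} (hM : n + 2 ≤ M)
    (hn : 1 ≤ n)
    (hx : x ∈ Binf d n) (hy : y ∈ Binf d n) (hxy : x k < y k) (hadj : ¬ Adj x y)
    (hx'k : (-1) * x' k = M + 1) (hy'k : 1 * y' k = M + 1) {z w : Fin d → ℤ}
    (hz : z ∈ ExtSet n M (-1) k x x' ∪ {x}) (hw : w ∈ ExtSet n M 1 k y y' ∪ {y}) :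
    2 ≤ norm1 (z - w) := by
  have h1 := abs_le.1 (hx k)
  have h2 := abs_le.1 (hy k)
  have hz' := ext_cases hx hx'k hz
  have hw' := ext_cases hy hy'k hw
  have hk := abs_le_norm1 (z - w) k
  have hk' := neg_abs_le ((z - w) k)
  simp only [Pi.sub_apply] at hk hk'
  rcases hz' with hz' | hz'
  · rcases hw' with hw' | hw'
    · have hxy2 : 2 ≤ norm1 (x - y) := by
        have h3 := abs_le_norm1 (x - y) k
        have h4 := neg_abs_le ((x - y) k)
        simp only [Pi.sub_apply] at h3 h4
        have : norm1 (x - y) ≠ 1 := hadj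
        omega
      refine hxy2.trans ?_
      unfold norm1
      apply Finset.sum_le_sum
      intro i _
      simp only [Pi.sub_apply]
      by_cases hik : i = k
      · subst hik
        rw [abs_of_neg (by omega), abs_of_neg (by omega)]; omega
      · have e1 := hz'.2 i hik
        have e2 := hw'.2 i hik
        rw [← e1, ← e2]
        rw [abs_le]
        have := neg_abs_le (z i - w i)
        have := le_abs_self (z i - w i)
        omega
    · omega
  · rcases hw' with hw' | hw' <;> omega

/-- The state of the construction. -/
def Good {d : ℕ} (r : ℤ) (E0 : Set (Fin d → ℤ) → Set (Fin d → ℤ)) (n : ℤ)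
    (x y : Fin d → ℤ) : Prop :=
  r ≤ n ∧ ∃ ω : Set (Fin d → ℤ), ω.Finite ∧ ω ⊆ Binf d n ∧ ω ∩ Sinf d n = {x, y} ∧
    ¬ Conn ω x y ∧ Conn (ω ∪ E0 ω) x y

lemma Good.symm' {d : ℕ} {r : ℤ} {E0 : Set (Fin d → ℤ) → Set (Fin d → ℤ)} {n : ℤ}
    {x y : Fin d → ℤ} (h : Good r E0 n x y) : Good r E0 n y x := by
  obtain ⟨h1, ω, h2, h3, h4, h5, h6⟩ := h
  exact ⟨h1, ω, h2, h3, by rw [h4, Set.pair_comm], fun h => h5 h.symm', h6.symm'⟩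

lemma finite_Binf (d : ℕ) (n : ℤ) : (Binf d n).Finite := by
  refine (Set.finite_Icc (fun _ : Fin d => -n) (fun _ => n)).subset ?_
  intro z hz
  exact ⟨fun i => (abs_le.1 (hz i)).1, fun i => (abs_le.1 (hz i)).2⟩

lemma Binf_mono {d : ℕ} {n m : ℤ} (h : n ≤ m) : Binf d n ⊆ Binf d m :=
  fun _ hz i => (hz i).trans h

lemma mem_Sinf_of {d : ℕ} {M : ℤ} (hM : 0 ≤ M) {σ : ℤ} (hσ : σ = 1 ∨ σ = -1) {k : Fin d}
    {x' : Fin d → ℤ} (hx'k : σ * x' k = M + 1) (hx' : ∀ i, i ≠ k → |x' i| ≤ M) :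
    x' ∈ Sinf d (M + 1) := by
  have h : |x' k| = M + 1 := by rw [sigma_abs hσ, hx'k, abs_of_nonneg (by omega)]
  refine ⟨fun i => ?_, k, h⟩
  by_cases hi : i = k
  · subst hi; omega
  · have := hx' i hi; omega

lemma Good.step {d : ℕ} {r : ℤ} (hr : 1 ≤ r) {E0 : Set (Fin d → ℤ) → Set (Fin d → ℤ)}
    (hloc : ∀ ω ω' : Set (Fin d → ℤ), ω ∩ Binf d r = ω' ∩ Binf d r → E0 ω = E0 ω')
    {n M : ℤ} {k : Fin d} {x y x' y' : Fin d → ℤ}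
    (h : Good r E0 n x y) (hxy : x k < y k) (hM : n + 2 ≤ M)
    (hx'k : (-1) * x' k = M + 1) (hx' : ∀ i, i ≠ k → |x' i| ≤ M)
    (hy'k : 1 * y' k = M + 1) (hy' : ∀ i, i ≠ k → |y' i| ≤ M) :
    Good r E0 (M + 1) x' y' := by
  obtain ⟨hrn, ω, hfin, hB, hS, hnc, hc⟩ := h
  have hn : 1 ≤ n := by omega
  have hxS : x ∈ ω ∩ Sinf d n := by rw [hS]; simp
  have hyS : y ∈ ω ∩ Sinf d n := by rw [hS]; simp
  have hadj : ¬ Adj x y := fun h => hnc (.single ⟨hxS.1, hyS.1, h⟩)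
  have hdist : ∀ {z w : Fin d → ℤ}, z ∈ ExtSet n M (-1) k x x' ∪ {x} →
      w ∈ ExtSet n M 1 k y y' ∪ {y} → 2 ≤ norm1 (z - w) := fun hz hw =>
    ext_dist hM hn (hB hxS.1) (hB hyS.1) hxy hadj hx'k hy'k hz hw
  have hnadj : ∀ {z w : Fin d → ℤ}, z ∈ ExtSet n M (-1) k x x' ∪ {x} →
      w ∈ ExtSet n M 1 k y y' ∪ {y} → ¬ Adj z w := fun hz hw h => by
    have := hdist hz hw
    unfold Adj at h
    omega
  set X := ExtSet n M (-1) k x x' with hX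
  set Y := ExtSet n M 1 k y y' with hY
  have hXo : ∀ z ∈ X, z ∉ Binf d n := fun z hz => ext_not_mem hM (.inr rfl) hx'k hz
  have hYo : ∀ z ∈ Y, z ∉ Binf d n := fun z hz => ext_not_mem hM (.inl rfl) hy'k hz
  have hx'S : x' ∈ Sinf d (M + 1) := mem_Sinf_of (by omega) (.inr rfl) hx'k hx'
  have hy'S : y' ∈ Sinf d (M + 1) := mem_Sinf_of (by omega) (.inl rfl) hy'k hy'
  have hx'X : x' ∈ X := .inr rfl
  have hy'Y : y' ∈ Y := .inr rfl
  have hsub : ω ∪ X ∪ Y ⊆ Binf d M ∪ {x', y'} := by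
    rintro z ((hz | hz) | hz)
    · exact .inl (Binf_mono (by omega) (hB hz))
    · rcases ext_bound hz with h | h
      · exact .inl h
      · exact .inr (.inl h)
    · rcases ext_bound hz with h | h
      · exact .inl h
      · exact .inr (.inr h)
  have hsub' : Binf d M ∪ {x', y'} ⊆ Binf d (M + 1) := by
    rintro z (hz | rfl | rfl)
    · exact Binf_mono (by omega) hz
    · exact hx'S.1
    · exact hy'S.1
  have hE : E0 (ω ∪ X ∪ Y) = E0 ω := by
    apply hloc
    ext z
    constructor
    · rintro ⟨(hz | hz) | hz, hzr⟩
      · exact ⟨hz, hzr⟩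
      · exact absurd (Binf_mono hrn hzr) (hXo z hz)
      · exact absurd (Binf_mono hrn hzr) (hYo z hz)
    · rintro ⟨hz, hzr⟩
      exact ⟨.inl (.inl hz), hzr⟩
  refine ⟨by omega, ω ∪ X ∪ Y, (finite_Binf d (M + 1)).subset (hsub.trans hsub'),
    hsub.trans hsub', ?_, ?_, ?_⟩
  · ext z
    constructor
    · rintro ⟨hz, hzS⟩
      rcases hsub hz with h | h
      · obtain ⟨-, i, hi⟩ := hzS
        have := h i
        omega
      · exact h
    · rintro (rfl | rfl)
      · exact ⟨.inl (.inr hx'X), hx'S⟩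
      · exact ⟨.inr hy'Y, hy'S⟩
  · intro hcon
    have key : ∀ z, Conn (ω ∪ X ∪ Y) x' z → (z ∈ ω ∧ Conn ω x z) ∨ z ∈ X := by
      intro z hz
      unfold Conn at hz
      induction hz with
      | refl => exact .inr hx'X
      | @tail z w _ hzw ih =>
        obtain ⟨-, hw, hzw⟩ := hzw
        rcases ih with ⟨hzω, hcz⟩ | hzX
        · rcases hw with (hw | hw) | hw
          · exact .inl ⟨hw, Relation.ReflTransGen.tail hcz ⟨hzω, hw, hzw⟩⟩
          · exact .inr hw
          · have : z ∈ ω ∩ Sinf d n := ⟨hzω, sinf_of_adj (hB hzω) (hYo w hw) hzw⟩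
            rw [hS] at this
            rcases this with rfl | h
            · exact absurd hzw (hnadj (.inr rfl) (.inl hw))
            · rw [Set.mem_singleton_iff] at h
              subst h
              exact absurd hcz hnc
        · rcases hw with (hw | hw) | hw
          · have : w ∈ ω ∩ Sinf d n := ⟨hw, sinf_of_adj (hB hw) (hXo z hzX) hzw.symm'⟩
            rw [hS] at this
            rcases this with rfl | h
            · exact .inl ⟨hw, .refl⟩
            · rw [Set.mem_singleton_iff] at h
              subst h
              exact absurd hzw (hnadj (.inl hzX) (.inr rfl))
          · exact .inr hw
          · exact absurd hzw (hnadj (.inl hzX) (.inl hw))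
    rcases key y' hcon with h | h
    · exact hYo y' hy'Y (hB h.1)
    · have := hdist (.inl h) (.inl hy'Y)
      rw [norm1_self] at this
      omega
  · rw [hE]
    have c1 : Conn (X ∪ {x}) x x' := by
      refine ext_conn hn hM (.inr rfl) hxS.2 ?_ hx'k hx'
      have := abs_le.1 (hyS.2.1 k); omega
    have c2 : Conn (Y ∪ {y}) y y' := by
      refine ext_conn hn hM (.inl rfl) hyS.2 ?_ hy'k hy'
      have := abs_le.1 (hxS.2.1 k); omega
    have s1 : X ∪ {x} ⊆ ω ∪ X ∪ Y ∪ E0 ω := by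
      rintro z (hz | rfl)
      · exact .inl (.inl (.inr hz))
      · exact .inl (.inl (.inl hxS.1))
    have s2 : Y ∪ {y} ⊆ ω ∪ X ∪ Y ∪ E0 ω := by
      rintro z (hz | rfl)
      · exact .inl (.inr hz)
      · exact .inl (.inl (.inl hyS.1))
    have s3 : ω ∪ E0 ω ⊆ ω ∪ X ∪ Y ∪ E0 ω := by
      rintro z (hz | hz)
      · exact .inl (.inl (.inl hz))
      · exact .inr hz
    exact ((c1.mono' s1).symm'.trans' (hc.mono' s3)).trans' (c2.mono' s2)

/-- From a good state, reach the axis. -/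
lemma Good.finish {d : ℕ} (hd : 2 ≤ d) {r : ℤ} (hr : 1 ≤ r)
    {E0 : Set (Fin d → ℤ) → Set (Fin d → ℤ)}
    (hloc : ∀ ω ω' : Set (Fin d → ℤ), ω ∩ Binf d r = ω' ∩ Binf d r → E0 ω = E0 ω')
    {n : ℤ} {x y : Fin d → ℤ} (h : Good r E0 n x y) (hxy : x ≠ y) :
    ∃ m, r < m ∧ Good r E0 m (eVec d (-m)) (eVec d m) := by
  obtain ⟨k, hk⟩ := Function.ne_iff.1 hxy
  wlog hlt : x k < y k generalizing x y
  · exact this h.symm' hxy.symm hk.symm (by omega)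
  have hrn := h.1
  have h1 := h.step hr hloc (M := n + 2) (k := k)
    (x' := fun i => if i = k then -(n + 3) else -(n + 2))
    (y' := fun i => if i = k then (n + 3) else (n + 2)) hlt le_rfl
    (by simp; ring) (by intro i hi; simp only [hi, if_false, abs_neg]; rw [abs_of_nonneg]; omega)
    (by simp; ring) (by intro i hi; simp only [hi, if_false]; rw [abs_of_nonneg]; omega)
  have h2 := h1.step hr hloc (M := n + 5) (k := ⟨0, by omega⟩)
    (x' := eVec d (-(n + 6))) (y' := eVec d (n + 6))
    (by split_ifs <;> omega) (by omega)
    (by simp [eVec]; ring)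
    (by
      intro i hi
      have : (i : ℕ) ≠ 0 := fun h => hi (Fin.ext h)
      simp [eVec, this]; omega)
    (by simp [eVec]; ring)
    (by
      intro i hi
      have : (i : ℕ) ≠ 0 := fun h => hi (Fin.ext h)
      simp [eVec, this]; omega)
  refine ⟨n + 6, by omega, ?_⟩
  have e : n + 5 + 1 = n + 6 := by ring
  rwa [e] at h2

lemma walk_of_conn {d : ℕ} {S : Set (Fin d → ℤ)} {x y : Fin d → ℤ} (hx : x ∈ S)
    (h : Conn S x y) : ∃ (l : ℕ) (p : ℕ → Fin d → ℤ), p 0 = x ∧ p l = y ∧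
      (∀ t ≤ l, p t ∈ S) ∧ ∀ t < l, Adj (p t) (p (t + 1)) := by
  unfold Conn at h
  induction h with
  | refl => exact ⟨0, fun _ => x, rfl, rfl, fun _ _ => hx, fun t ht => by omega⟩
  | @tail z w _ hzw ih =>
    obtain ⟨l, p, h0, hl, hS, hA⟩ := ih
    refine ⟨l + 1, fun t => if t ≤ l then p t else w, by simp [h0], by simp, ?_, ?_⟩
    · intro t ht
      dsimp only
      split_ifs with h
      · exact hS t h
      · exact hzw.2.1
    · intro t ht
      dsimp only
      rw [if_pos (by omega : t ≤ l)]
      split_ifs with h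
      · exact hA t (by omega)
      · have : t = l := by omega
        subst this
        rw [hl]; exact hzw.2.2

lemma dip_of_conn {d : ℕ} {S : Set (Fin d → ℤ)} {g : ℤ → Fin d → ℤ}
    (hg : Function.Injective g) (hadj : ∀ i, Adj (g i) (g (i + 1))) {a b : ℤ} (hab : a < b)
    (ha : ∀ i ≤ a, g i ∈ S) (hb : ∀ i, b ≤ i → g i ∈ S) (hc : Conn S (g a) (g b)) :
    HasDoublyInfinitePath S := by
  classical
  let Q : ℕ → Prop := fun l => ∃ (p : ℕ → Fin d → ℤ) (i j : ℤ), i ≤ a ∧ b ≤ j ∧ p 0 = g i ∧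
    p l = g j ∧ (∀ t ≤ l, p t ∈ S) ∧ ∀ t < l, Adj (p t) (p (t + 1))
  have hQ : ∃ l, Q l := by
    obtain ⟨l, p, h0, hl, hS, hA⟩ := walk_of_conn (ha a le_rfl) hc
    exact ⟨l, p, a, b, le_rfl, le_rfl, h0, hl, hS, hA⟩
  obtain ⟨p, i, j, hi, hj, h0, hl, hS, hA⟩ := Nat.find_spec hQ
  have hmin : ∀ l', Q l' → Nat.find hQ ≤ l' := fun l' h => Nat.find_min' hQ h
  set l := Nat.find hQ with hldef
  clear_value l
  -- the walk is injective
  have hinj : ∀ s t, s < t → t ≤ l → p s ≠ p t := by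
    intro s t hst htl heq
    have := hmin (l - (t - s)) ⟨fun u => if u ≤ s then p u else p (u + (t - s)), i, j, hi, hj,
      by simp [h0], ?_, ?_, ?_⟩
    · omega
    · dsimp only
      split_ifs with h
      · have e1 : t = l := by omega
        have e2 : l - (t - s) = s := by omega
        rw [e2, heq, e1, hl]
      · rw [← hl]; congr 1; omega
    · intro u hu
      dsimp only
      split_ifs with h
      · exact hS u (by omega)
      · exact hS _ (by omega)
    · intro u hu
      dsimp only
      by_cases h : u + 1 ≤ s
      · rw [if_pos (by omega), if_pos h]; exact hA u (by omega)
      · rw [if_neg h]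
        by_cases h' : u ≤ s
        · have : u = s := by omega
          subst this
          rw [if_pos le_rfl, heq]
          have := hA t (by omega)
          rwa [show u + 1 + (t - u) = t + 1 by omega]
        · rw [if_neg h']
          have := hA (u + (t - s)) (by omega)
          rwa [show u + 1 + (t - s) = u + (t - s) + 1 by omega]
  have hpA : ∀ t, 0 < t → t ≤ l → ∀ i' ≤ a, p t ≠ g i' := by
    intro t ht htl i' hi' heq
    have := hmin (l - t) ⟨fun u => p (u + t), i', j, hi', hj, by simpa using heq, ?_, ?_, ?_⟩
    · omega
    · dsimp only; rw [← hl]; congr 1; omega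
    · intro u hu; exact hS _ (by omega)
    · intro u hu
      have := hA (u + t) (by omega)
      dsimp only
      rwa [show u + 1 + t = u + t + 1 by omega]
  have hpB : ∀ t, t < l → ∀ j', b ≤ j' → p t ≠ g j' := by
    intro t htl j' hj' heq
    have := hmin t ⟨p, i, j', hi, hj', h0, heq, fun u hu => hS u (by omega),
      fun u hu => hA u (by omega)⟩
    omega
  let f : ℤ → Fin d → ℤ := fun t => if t < 0 then g (i + t) else
    if t ≤ l then p t.toNat else g (j + (t - l))
  have f1 : ∀ t < 0, f t = g (i + t) := fun t ht => by simp only [f]; rw [if_pos ht]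
  have f2 : ∀ t : ℤ, 0 ≤ t → t ≤ l → f t = p t.toNat := fun t ht ht' => by
    simp only [f]; rw [if_neg (by omega), if_pos ht']
  have f3 : ∀ t, (l : ℤ) < t → f t = g (j + (t - l)) := fun t ht => by
    simp only [f]; rw [if_neg (by omega), if_neg (by omega)]
  have hne : ∀ s t, s < t → f s ≠ f t := by
    intro s t hst
    rcases lt_or_ge s 0 with hs | hs
    · rw [f1 s hs]
      rcases lt_or_ge t 0 with ht | ht
      · rw [f1 t ht]; intro h; have := hg h; omega
      · rcases le_or_gt t l with ht' | ht'
        · rw [f2 t ht ht']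
          rcases ht.eq_or_lt with h | h
          · subst h
            intro h; simp only [Int.toNat_zero, h0] at h
            have := hg h; omega
          · exact (hpA _ (by omega) (by omega) _ (by omega)).symm
        · rw [f3 t ht']; intro h; have := hg h; omega
    · rcases le_or_gt s l with hs' | hs'
      · rw [f2 s hs hs']
        rcases le_or_gt t l with ht' | ht'
        · rw [f2 t (by omega) ht']
          exact hinj _ _ (by omega) (by omega)
        · rw [f3 t ht']
          rcases hs'.eq_or_lt with h | h
          · subst h
            intro h; simp only [Int.toNat_natCast, hl] at h
            have := hg h; omega
          · exact hpB _ (by omega) _ (by omega)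
      · rw [f3 s hs', f3 t (by omega)]; intro h; have := hg h; omega
  refine ⟨f, ?_, ?_⟩
  · intro s t h
    rcases lt_trichotomy s t with h' | h' | h'
    · exact absurd h (hne s t h')
    · exact h'
    · exact absurd h.symm (hne t s h')
  · intro t
    constructor
    · rcases lt_or_ge t 0 with ht | ht
      · rw [f1 t ht]; exact ha _ (by omega)
      · rcases le_or_gt t l with ht' | ht'
        · rw [f2 t ht ht']; exact hS _ (by omega)
        · rw [f3 t ht']; exact hb _ (by omega)
    · rcases lt_or_ge t 0 with ht | ht
      · rw [f1 t ht]
        rcases lt_or_ge (t + 1) 0 with ht1 | ht1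
        · rw [f1 _ ht1, ← add_assoc]; exact hadj _
        · have : t = -1 := by omega
          subst this
          rw [f2 _ (by omega) (by omega)]
          have := hadj (i + -1)
          simpa [h0] using this
      · rcases lt_or_ge t l with ht' | ht'
        · rw [f2 t ht ht'.le, f2 (t + 1) (by omega) (by omega)]
          rw [show (t + 1).toNat = t.toNat + 1 by omega]
          exact hA _ (by omega)
        · rw [f3 (t + 1) (by omega)]
          rcases ht'.eq_or_lt with h | h
          · subst h
            rw [f2 _ (by omega) le_rfl, Int.toNat_natCast, hl]
            have := hadj j
            rwa [show j + ((l : ℤ) + 1 - l) = j + 1 by omega]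
          · rw [f3 t h]
            have := hadj (j + (t - l))
            rwa [show j + (t + 1 - (l : ℤ)) = j + (t - l) + 1 by omega]

lemma escape {d : ℕ} {f : ℤ → Fin d → ℤ} (hf : Function.Injective f) (N : ℤ) :
    ∃ K : ℕ, ∀ i : ℤ, (K : ℤ) ≤ |i| → f i ∉ Binf d N := by
  have hfin : (f ⁻¹' Binf d N).Finite := (finite_Binf d N).preimage hf.injOn
  obtain ⟨B, hB⟩ := (hfin.image (fun i => |i|)).bddAbove
  refine ⟨(B + 1).toNat, fun i hi h => ?_⟩
  have h1 : |i| ≤ B := hB ⟨i, h, rfl⟩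
  omega

lemma contain {d : ℕ} (f : ℤ → Fin d → ℤ) (K : ℕ) (r : ℤ) :
    ∃ N : ℤ, r ≤ N ∧ ∀ i : ℤ, |i| ≤ K → f i ∈ Binf d N := by
  have hfin : (Set.Icc (-(K : ℤ)) K ×ˢ (Set.univ : Set (Fin d))).Finite :=
    (Set.finite_Icc _ _).prod Set.finite_univ
  obtain ⟨B, hB⟩ := (hfin.image (fun q => |f q.1 q.2|)).bddAbove
  refine ⟨max r B, le_max_left _ _, fun i hi k => le_max_of_le_right ?_⟩
  exact hB ⟨(i, k), ⟨abs_le.1 hi, trivial⟩, rfl⟩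

lemma sinf_succ {d : ℕ} {N : ℤ} {z w : Fin d → ℤ} (hz : z ∈ Binf d N) (hw : w ∉ Binf d N)
    (h : Adj z w) : w ∈ Sinf d (N + 1) := by
  have hb : ∀ i, |w i| ≤ N + 1 := fun i => by
    have h1 := h.coord i
    have h2 := hz i
    have h3 := abs_sub_abs_le_abs_sub (w i) (z i)
    rw [abs_sub_comm] at h3
    omega
  refine ⟨hb, ?_⟩
  simp only [Binf, Set.mem_ofPred_eq, not_forall, not_le] at hw
  obtain ⟨i, hi⟩ := hw
  exact ⟨i, by have := hb i; omega⟩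

lemma conn_seg {d : ℕ} {S : Set (Fin d → ℤ)} {f : ℤ → Fin d → ℤ}
    (hadj : ∀ i, Adj (f i) (f (i + 1))) (a : ℤ) (n : ℕ)
    (hS : ∀ i, a ≤ i → i ≤ a + n → f i ∈ S) : Conn S (f a) (f (a + n)) := by
  induction n with
  | zero => simp only [Nat.cast_zero, add_zero]; exact .refl
  | succ n ih =>
    have h1 := ih (fun i h h' => hS i h (by push_cast; omega))
    have h2 := hadj (a + n)
    rw [add_assoc] at h2
    push_cast at hS ⊢
    exact .tail h1 ⟨hS _ (by omega) (by omega), hS _ (by omega) (by omega), h2⟩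

lemma start {d : ℕ} {r : ℤ} (E0 : Set (Fin d → ℤ) → Set (Fin d → ℤ))
    (hloc : ∀ ω ω' : Set (Fin d → ℤ), ω ∩ Binf d r = ω' ∩ Binf d r → E0 ω = E0 ω')
    (hrange : ∀ ω : Set (Fin d → ℤ), E0 ω ⊆ Binf d r)
    (hess : ∃ ω' : Set (Fin d → ℤ),
      ¬ HasDoublyInfinitePath ω' ∧ HasDoublyInfinitePath (ω' ∪ E0 ω')) :
    ∃ n x y, x ≠ y ∧ Good r E0 n x y := by
  classical
  obtain ⟨ω', hno, f, hf, hfp⟩ := hess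
  have hadj : ∀ i, Adj (f i) (f (i + 1)) := fun i => (hfp i).2
  obtain ⟨K, hK⟩ := escape hf r
  obtain ⟨N, hrN, hN⟩ := contain f K r
  obtain ⟨K', hK'⟩ := escape hf N
  have hout : ∀ i : ℤ, f i ∉ Binf d r → f i ∈ ω' := fun i hi => by
    rcases (hfp i).1 with h | h
    · exact h
    · exact absurd (hrange _ h) hi
  have hb : ∃ b : ℕ, f b ∉ Binf d N := ⟨K', hK' _ (by simp)⟩
  have ha : ∃ a : ℕ, f (-(a : ℤ)) ∉ Binf d N := ⟨K', hK' _ (by simp)⟩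
  have hb1 := Nat.find_spec hb
  have ha1 := Nat.find_spec ha
  have hb2 : ∀ t < Nat.find hb, f t ∈ Binf d N := fun t ht => not_not.1 (Nat.find_min hb ht)
  have ha2 : ∀ t < Nat.find ha, f (-(t : ℤ)) ∈ Binf d N :=
    fun t ht => not_not.1 (Nat.find_min ha ht)
  set b := Nat.find hb with hbdef
  set a := Nat.find ha with hadef
  clear_value a b
  have hKb : K < b := by
    by_contra h
    exact hb1 (hN _ (by rw [abs_of_nonneg] <;> omega))
  have hKa : K < a := by
    by_contra h
    exact ha1 (hN _ (by rw [abs_neg, abs_of_nonneg] <;> omega))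
  have hmid : ∀ i : ℤ, -(a : ℤ) < i → i < b → f i ∈ Binf d N := by
    intro i h1 h2
    rcases le_or_gt 0 i with h | h
    · have := hb2 i.toNat (by omega)
      rwa [Int.toNat_of_nonneg h] at this
    · have := ha2 (-i).toNat (by omega)
      rwa [Int.toNat_of_nonneg (by omega), neg_neg] at this
  have hyS : f b ∈ Sinf d (N + 1) := by
    refine sinf_succ (hmid (b - 1) (by omega) (by omega)) hb1 ?_
    have := hadj (b - 1)
    rwa [sub_add_cancel] at this
  have hxS : f (-(a : ℤ)) ∈ Sinf d (N + 1) :=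
    sinf_succ (hmid (-(a : ℤ) + 1) (by omega) (by omega)) ha1 (hadj _).symm'
  have hyω : ∀ i : ℤ, (b : ℤ) ≤ i → f i ∈ ω' := fun i hi =>
    hout i (hK i (by rw [abs_of_nonneg] <;> omega))
  have hxω : ∀ i : ℤ, i ≤ -(a : ℤ) → f i ∈ ω' := fun i hi =>
    hout i (hK i (by rw [abs_of_neg] <;> omega))
  set ω : Set (Fin d → ℤ) := (ω' ∩ Binf d N) ∪ {f (-(a : ℤ)), f b} with hω
  have hsub : ω ⊆ ω' := by
    rintro z (hz | rfl | rfl)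
    · exact hz.1
    · exact hxω _ le_rfl
    · exact hyω _ le_rfl
  have hE : E0 ω = E0 ω' := by
    apply hloc
    ext z
    constructor
    · rintro ⟨h, h'⟩; exact ⟨hsub h, h'⟩
    · rintro ⟨h, h'⟩; exact ⟨.inl ⟨h, Binf_mono hrN h'⟩, h'⟩
  have hωB : ω ⊆ Binf d (N + 1) := by
    rintro z (hz | rfl | rfl)
    · exact Binf_mono (by omega) hz.2
    · exact hxS.1
    · exact hyS.1
  refine ⟨N + 1, f (-(a : ℤ)), f b, ?_, by omega, ω, (finite_Binf d _).subset hωB, hωB, ?_, ?_, ?_⟩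
  · intro h; have := hf h; omega
  · ext z
    constructor
    · rintro ⟨hz | hz, hzS⟩
      · obtain ⟨-, i, hi⟩ := hzS
        have := hz.2 i
        omega
      · exact hz
    · rintro (rfl | rfl)
      · exact ⟨.inr (.inl rfl), hxS⟩
      · exact ⟨.inr (.inr rfl), hyS⟩
  · intro hc
    exact hno (dip_of_conn hf hadj (by omega) hxω hyω (hc.mono' hsub))
  · rw [hE]
    have := conn_seg (S := ω ∪ E0 ω') hadj (-(a : ℤ)) (a + b) ?_
    · rwa [show -(a : ℤ) + ((a + b : ℕ) : ℤ) = b by push_cast; ring] at this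
    · intro i h1 h2
      push_cast at h2
      rcases h1.eq_or_lt with h | h
      · subst h; exact .inl (.inr (.inl rfl))
      · rcases lt_or_ge i b with h' | h'
        · rcases (hfp i).1 with h3 | h3
          · exact .inl (.inl ⟨h3, hmid i h h'⟩)
          · exact .inr h3
        · have : i = b := by omega
          subst this; exact .inl (.inr (.inr rfl))

theorem statement4 (d : ℕ) (hd : 2 ≤ d) (r : ℤ) (hr : 1 ≤ r)
    (E0 : Set (Fin d → ℤ) → Set (Fin d → ℤ))
    (hloc : ∀ ω ω' : Set (Fin d → ℤ), ω ∩ Binf d r = ω' ∩ Binf d r → E0 ω = E0 ω')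
    (hrange : ∀ ω : Set (Fin d → ℤ), E0 ω ⊆ Binf d r)
    (hess : ∃ ω' : Set (Fin d → ℤ),
      ¬ HasDoublyInfinitePath ω' ∧ HasDoublyInfinitePath (ω' ∪ E0 ω')) :
    ∃ m : ℤ, r < m ∧
      ∃ ω : Set (Fin d → ℤ), ω.Finite ∧ ω ⊆ Binf d m ∧
        ω ∩ Sinf d m = {eVec d m, eVec d (-m)} ∧
        ¬ HasPathJoining ω (eVec d (-m)) (eVec d m) ∧
        HasPathJoining (ω ∪ E0 ω) (eVec d (-m)) (eVec d m) := by
  obtain ⟨n, x, y, hxy, hgood⟩ := start E0 hloc hrange hess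
  obtain ⟨m, hm, -, ω, hfin, hB, hS, hnc, hc⟩ := hgood.finish hd hr hloc hxy
  have hx : eVec d (-m) ∈ ω ∩ Sinf d m := by rw [hS]; simp
  exact ⟨m, hm, ω, hfin, hB, by rw [hS, Set.pair_comm], fun h => hnc (conn_of_hasPath h),
    hasPath_of_conn (.inl hx.1) hc⟩
end

section
/- Let d ≥ 2, m ≥ 1 and r ≥ m + 10. Let u = (u₁,…,u_d) and v = (v₁,…,v_d) be points of S¹_r such that for some coordinate i and some integer s with |s| ≤ r−5 either u_i > s > v_i or v_i > s > u_i. Then there exist a path P_u starting at u and a path P_v starting at v such that: one of them ends at e_m and the other ends at −e_m; every vertex of P_u and of P_v other than the first and last vertex of each path lies in B¹_{r−1} \ B¹_m; and no vertex of P_u equals or is adjacent to any vertex of P_v. -/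
/-- A (self-avoiding) path in the grid graph `ℤ^d`: a nonempty list of distinct
points in which consecutive points are adjacent. -/
def IsPath {d : ℕ} (P : List (Fin d → ℤ)) : Prop :=
  P ≠ [] ∧ P.Nodup ∧ P.Chain' Adj

namespace S5

variable {d : ℕ}

theorem norm1_update (p : Fin d → ℤ) (j : Fin d) (a : ℤ) :
    norm1 (Function.update p j a) = norm1 p - |p j| + |a| := by
  unfold norm1
  rw [← Finset.add_sum_erase _ _ (Finset.mem_univ j),
    ← Finset.add_sum_erase Finset.univ (fun i => |p i|) (Finset.mem_univ j)]
  have : ∑ x ∈ Finset.univ.erase j, |Function.update p j a x|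
      = ∑ x ∈ Finset.univ.erase j, |p x| := by
    apply Finset.sum_congr rfl
    intro x hx
    rw [Function.update_of_ne (Finset.ne_of_mem_erase hx)]
  rw [this]
  simp
  ring

theorem norm1_zero : norm1 (0 : Fin d → ℤ) = 0 := by simp [norm1]

theorem norm1_nonneg (p : Fin d → ℤ) : 0 ≤ norm1 p :=
  Finset.sum_nonneg (fun _ _ => abs_nonneg _)

theorem norm1_neg (p : Fin d → ℤ) : norm1 (-p) = norm1 p := by simp [norm1]

theorem abs_le_norm1 (p : Fin d → ℤ) (i : Fin d) : |p i| ≤ norm1 p :=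
  Finset.single_le_sum (f := fun i => |p i|) (fun _ _ => abs_nonneg _) (Finset.mem_univ i)

theorem norm1_single (j : Fin d) (a : ℤ) : norm1 (Pi.single j a : Fin d → ℤ) = |a| := by
  have := norm1_update (0 : Fin d → ℤ) j a
  rw [norm1_zero] at this
  simpa [Pi.single] using this

theorem norm1_single_sub (j : Fin d) (a : ℤ) (q : Fin d → ℤ) :
    norm1 ((Pi.single j a : Fin d → ℤ) - q) = |a - q j| + norm1 q - |q j| := by
  have h := norm1_update (-q) j (a - q j)
  have e : (Pi.single j a : Fin d → ℤ) - q = Function.update (-q) j (a - q j) := by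
    funext k
    by_cases hk : k = j
    · subst hk; simp
    · simp [hk]
  rw [e, h, norm1_neg]
  simp
  ring

theorem norm1_sub_comm (p q : Fin d → ℤ) : norm1 (p - q) = norm1 (q - p) := by
  rw [← norm1_neg, neg_sub]

/-- Grid graph restricted to a set. -/
def GG (S : Set (Fin d → ℤ)) : SimpleGraph (Fin d → ℤ) where
  Adj a b := Adj a b ∧ a ∈ S ∧ b ∈ S
  symm := ⟨fun a b h => ⟨by have := h.1; unfold _root_.Adj at *; rw [norm1_sub_comm]; exact this, h.2.2, h.2.1⟩⟩
  loopless := ⟨fun a h => by have := h.1; unfold _root_.Adj at this; simp [norm1] at this⟩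

def Reach (S : Set (Fin d → ℤ)) (p q : Fin d → ℤ) : Prop := (GG S).Reachable p q

theorem Reach.mono {S T : Set (Fin d → ℤ)} {p q} (h : Reach S p q) (hST : ∀ x ∈ S, x ∈ T) :
    Reach T p q :=
  SimpleGraph.Reachable.mono (G := GG S) (G' := GG T)
    (fun _ _ hab => ⟨hab.1, hST _ hab.2.1, hST _ hab.2.2⟩) h

theorem Reach.trans {S : Set (Fin d → ℤ)} {p q w} (h : Reach S p q) (h' : Reach S q w) :
    Reach S p w := SimpleGraph.Reachable.trans h h'

theorem Reach.step {S : Set (Fin d → ℤ)} {p q} (h : _root_.Adj p q) (hp : p ∈ S) (hq : q ∈ S) :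
    Reach S p q := SimpleGraph.Adj.reachable (G := GG S) ⟨h, hp, hq⟩

theorem Reach.map {S T : Set (Fin d → ℤ)} {p q} (f : (Fin d → ℤ) → (Fin d → ℤ))
    (hf : ∀ a b, norm1 (f a - f b) = norm1 (a - b)) (hST : ∀ x ∈ S, f x ∈ T)
    (h : Reach S p q) : Reach T (f p) (f q) := by
  let F : GG S →g GG T := ⟨f, fun {a b} hab => ⟨by
    have := hab.1; unfold _root_.Adj at *; rw [hf]; exact this, hST _ hab.2.1, hST _ hab.2.2⟩⟩
  exact SimpleGraph.Reachable.map F h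

theorem Reach.toList {S : Set (Fin d → ℤ)} {p q} (h : Reach S p q) (hp : p ∈ S) :
    ∃ (P : List (Fin d → ℤ)) (hP : P ≠ []), IsPath P ∧ P.head hP = p ∧ P.getLast hP = q ∧
      ∀ x ∈ P, x ∈ S := by
  classical
  obtain ⟨w⟩ := h
  refine ⟨w.toPath.1.support, w.toPath.1.support_ne_nil,
    ⟨w.toPath.1.support_ne_nil, w.toPath.2.support_nodup, ?_⟩, by simp, by simp, ?_⟩
  · exact List.IsChain.imp (fun a b hab => hab.1) (w.toPath.1.isChain_adj_support)
  · have key : ∀ {a b} (w : (GG S).Walk a b), a ∈ S → ∀ x ∈ w.support, x ∈ S := by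
      intro a b w
      induction w with
      | nil => intro ha x hx; simp at hx; subst hx; exact ha
      | cons hab w ih =>
        intro ha x hx
        simp at hx
        rcases hx with rfl | hx
        · exact ha
        · exact ih hab.2.2 x hx
    exact key _ hp

def Btw (a b c : ℤ) : Prop := (a ≤ c ∧ c ≤ b) ∨ (b ≤ c ∧ c ≤ a)

def Compat (p t : Fin d → ℤ) : Prop := ∀ j, (0 ≤ p j ∧ 0 ≤ t j) ∨ (p j ≤ 0 ∧ t j ≤ 0)

theorem exists_dec {p t : Fin d → ℤ} (hc : Compat p t) (hne : p ≠ t) (hn : norm1 t ≤ norm1 p) :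
    ∃ j, |t j| < |p j| := by
  by_contra! hcon
  have h1 : norm1 p = norm1 t := le_antisymm (Finset.sum_le_sum (fun j _ => hcon j)) hn
  have h2 := (Finset.sum_eq_sum_iff_of_le (s := Finset.univ) (f := fun j => |p j|)
    (g := fun j => |t j|) (fun j _ => hcon j)).1 h1
  apply hne
  funext j
  have h3 := h2 j (Finset.mem_univ j)
  rcases hc j with h | h
  · rwa [abs_of_nonneg h.1, abs_of_nonneg h.2] at h3
  · rw [abs_of_nonpos h.1, abs_of_nonpos h.2] at h3; omega

theorem exists_inc {p t : Fin d → ℤ} (hn : norm1 p < norm1 t) :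
    ∃ j, |p j| < |t j| := by
  obtain ⟨j, _, h⟩ := Finset.exists_lt_of_sum_lt hn
  exact ⟨j, h⟩

def LSet (p t : Fin d → ℤ) : Set (Fin d → ℤ) :=
  {q | (∀ j, Btw (p j) (t j) (q j)) ∧ (q = p ∨ norm1 q ≤ max (norm1 p - 1) (norm1 t)) ∧
    min (norm1 p) (norm1 t - 1) ≤ norm1 q}

theorem adj_update (p : Fin d → ℤ) (j : Fin d) (a : ℤ) (h : |p j - a| = 1) :
    _root_.Adj p (Function.update p j a) := by
  unfold _root_.Adj
  have : p - Function.update p j a = Pi.single j (p j - a) := by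
    funext k
    by_cases hk : k = j
    · subst hk; simp
    · simp [hk]
  rw [this, norm1_single, h]

theorem L_aux (n : ℕ) : ∀ p t : Fin d → ℤ, norm1 (p - t) ≤ n → Compat p t →
    Reach (LSet p t) p t := by
  induction n with
  | zero =>
    intro p t h _
    have : p = t := by
      funext j
      have := abs_le_norm1 (p - t) j
      simp only [Pi.sub_apply] at this
      have h2 : |p j - t j| ≤ 0 := by push_cast at h; omega
      have := abs_nonpos_iff.1 h2
      omega
    subst this
    exact SimpleGraph.Reachable.refl _
  | succ n ih =>
    intro p t h hc
    by_cases hpt : p = t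
    · subst hpt; exact SimpleGraph.Reachable.refl _
    -- common step
    have step : ∀ j : Fin d, ∀ a : ℤ, |p j - a| = 1 → |a - t j| = |p j - t j| - 1 →
        ((norm1 t ≤ norm1 p ∧ |a| = |p j| - 1) ∨ (norm1 p < norm1 t ∧ |a| = |p j| + 1)) →
        Btw (p j) (t j) a → Reach (LSet p t) p t := by
      intro j a h1 h2 h3 h4
      set p' := Function.update p j a with hp'
      have hn : norm1 p' = norm1 p - |p j| + |a| := norm1_update _ _ _
      have hp'j : p' j = a := by simp [hp']
      have hp'k : ∀ k, k ≠ j → p' k = p k := fun k hk => by simp [hp', hk]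
      have hbt : ∀ k, Btw (p k) (t k) (p' k) := by
        intro k
        by_cases hk : k = j
        · subst hk; rw [hp'j]; exact h4
        · rw [hp'k k hk]; unfold Btw; omega
      have hd : norm1 (p' - t) ≤ n := by
        have e : p' - t = Function.update (p - t) j (a - t j) := by
          funext k
          by_cases hk : k = j
          · subst hk; simp [hp']
          · simp [hp', hk]
        rw [e, norm1_update]
        simp only [Pi.sub_apply]
        push_cast at h
        omega
      have hc' : Compat p' t := by
        intro k
        have := hc k
        have h5 := hbt k
        unfold Btw at h5
        omega
      have hr := ih p' t hd hc'
      have hp : p ∈ LSet p t := ⟨fun k => by unfold Btw; omega, Or.inl rfl, by omega⟩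
      have hp'm : p' ∈ LSet p t := ⟨hbt, Or.inr (by omega), by omega⟩
      refine Reach.trans (Reach.step (adj_update p j a h1) hp hp'm) (hr.mono ?_)
      rintro q ⟨hq1, hq2, hq3⟩
      refine ⟨fun k => ?_, Or.inr ?_, by omega⟩
      · have := hq1 k
        have h5 := hbt k
        unfold Btw at *
        omega
      · rcases hq2 with rfl | hq2
        · omega
        · omega
    by_cases hle : norm1 t ≤ norm1 p
    · obtain ⟨j, hj⟩ := exists_dec hc hpt hle
      have hcj := hc j
      by_cases hlt : p j < t j
      · exact step j (p j + 1) (by grind) (by grind) (Or.inl ⟨hle, by grind⟩) (by unfold Btw; omega)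
      · exact step j (p j - 1) (by grind) (by grind) (Or.inl ⟨hle, by grind⟩) (by unfold Btw; grind)
    · have hle := not_le.1 hle
      obtain ⟨j, hj⟩ := exists_inc hle
      have hcj := hc j
      by_cases hlt : p j < t j
      · exact step j (p j + 1) (by grind) (by grind) (Or.inr ⟨hle, by grind⟩) (by unfold Btw; omega)
      · exact step j (p j - 1) (by grind) (by grind) (Or.inr ⟨hle, by grind⟩) (by unfold Btw; grind)

theorem L (p t : Fin d → ℤ) (hc : Compat p t) : Reach (LSet p t) p t :=
  L_aux (norm1 (p - t)).toNat p t (by have := norm1_nonneg (p - t); omega) hc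

/-- Moving along an axis. -/
theorem axis (z : Fin d) (a b : ℤ) (h : (0 ≤ a ∧ 0 ≤ b) ∨ (a ≤ 0 ∧ b ≤ 0)) :
    Reach {q | q = Pi.single z (q z) ∧ norm1 q = |q z| ∧ Btw a b (q z)}
      (Pi.single z a) (Pi.single z b) := by
  refine (L _ _ ?_).mono ?_
  · intro j
    by_cases hj : j = z
    · subst hj; simpa using h
    · simp [hj]
  · rintro q ⟨hq, -, -⟩
    have e : q = Pi.single z (q z) := by
      funext j
      by_cases hj : j = z
      · subst hj; simp
      · have := hq j
        simp [hj, Btw] at this ⊢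
        omega
    refine ⟨e, ?_, ?_⟩
    · conv_lhs => rw [e]
      exact norm1_single _ _
    · simpa using hq z

/-- Moving to a pole at height `r-1`. -/
theorem pole (r : ℤ) (p : Fin d → ℤ) (hp : norm1 p = r ∨ norm1 p = r - 1) (i : Fin d)
    (c : ℤ) (hc : |c| = r - 1) (hs : (0 ≤ p i ∧ 0 ≤ c) ∨ (p i ≤ 0 ∧ c ≤ 0)) :
    Reach {q | Btw (p i) c (q i) ∧ (∀ j, j ≠ i → Btw (p j) 0 (q j)) ∧
      (q = p ∨ norm1 q ≤ r - 1) ∧ r - 2 ≤ norm1 q} p (Pi.single i c) := by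
  refine (L _ _ ?_).mono ?_
  · intro j
    by_cases hj : j = i
    · subst hj; simpa using hs
    · simp [hj]; omega
  · rintro q ⟨hq, h1, h2⟩
    rw [norm1_single] at h1 h2
    refine ⟨by simpa using hq i, fun j hj => by simpa [hj] using hq j, ?_, by omega⟩
    rcases h1 with h1 | h1
    · exact Or.inl h1
    · right; omega

def Good (z : Fin d) (m r : ℤ) (u v : Fin d → ℤ) : Prop :=
  ∃ (S T : Set (Fin d → ℤ)) (c : ℤ), (c = m ∨ c = -m) ∧ u ∈ S ∧ v ∈ T ∧
    Reach S u (Pi.single z c) ∧ Reach T v (Pi.single z (-c)) ∧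
    (∀ x ∈ S, x = u ∨ x = Pi.single z c ∨ (norm1 x ≤ r - 1 ∧ m < norm1 x)) ∧
    (∀ x ∈ T, x = v ∨ x = Pi.single z (-c) ∨ (norm1 x ≤ r - 1 ∧ m < norm1 x)) ∧
    (∀ x ∈ S, ∀ y ∈ T, 2 ≤ norm1 (x - y))

theorem Good.symm {z : Fin d} {m r : ℤ} {u v} (h : Good z m r u v) : Good z m r v u := by
  obtain ⟨S, T, c, h1, h2, h3, h4, h5, h6, h7, h8⟩ := h
  refine ⟨T, S, -c, by omega, h3, h2, h5, by simpa using h4, h7, by simpa using h6, ?_⟩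
  intro x hx y hy
  rw [norm1_sub_comm]; exact h8 y hy x hx

theorem Good.refl_signs {z : Fin d} {m r : ℤ} {u v} (ε : Fin d → ℤ) (hε : ∀ j, ε j = 1 ∨ ε j = -1)
    (h : Good z m r (ε * u) (ε * v)) : Good z m r u v := by
  have hee : ε * ε = 1 := by
    funext j
    rcases hε j with h | h <;> simp [h]
  have hinv : ∀ x, ε * (ε * x) = x := fun x => by rw [← mul_assoc, hee, one_mul]
  have hnorm : ∀ x, norm1 (ε * x) = norm1 x := by
    intro x
    unfold norm1
    apply Finset.sum_congr rfl
    intro j _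
    rcases hε j with h | h <;> simp [h]
  have hsub : ∀ x y, norm1 (ε * x - ε * y) = norm1 (x - y) := by
    intro x y
    rw [← mul_sub, hnorm]
  have hsing : ∀ c : ℤ, ε * (Pi.single z c : Fin d → ℤ) = Pi.single z (ε z * c) := by
    intro c
    funext j
    by_cases hj : j = z
    · subst hj; simp
    · simp [hj]
  obtain ⟨S, T, c, h1, h2, h3, h4, h5, h6, h7, h8⟩ := h
  refine ⟨{x | ε * x ∈ S}, {x | ε * x ∈ T}, ε z * c, ?_, h2, h3, ?_, ?_, ?_, ?_, ?_⟩
  · rcases hε z with h | h <;> rw [h] <;> omega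
  · have := Reach.map (T := {x | ε * x ∈ S}) (fun x => ε * x) hsub
      (fun x hx => by simpa [hinv] using hx) h4
    simpa only [hinv, hsing] using this
  · have := Reach.map (T := {x | ε * x ∈ T}) (fun x => ε * x) hsub
      (fun x hx => by simpa [hinv] using hx) h5
    simpa only [hinv, hsing, mul_neg] using this
  · intro x hx
    rcases h6 _ hx with h | h | h
    · left; rw [← hinv x, h, hinv]
    · right; left; rw [← hinv x, h, hsing]
    · right; right; rwa [hnorm] at h
  · intro x hx
    rcases h7 _ hx with h | h | h
    · left; rw [← hinv x, h, hinv]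
    · right; left; rw [← hinv x, h, hsing, mul_neg]
    · right; right; rwa [hnorm] at h
  · intro x hx y hy
    rw [← hsub]
    exact h8 _ hx _ hy

theorem Good.final {z : Fin d} {m r : ℤ} {u v} (hz : (z : ℕ) = 0) (h : Good z m r u v) :
    ∃ (Pu Pv : List (Fin d → ℤ)) (hPu : Pu ≠ []) (hPv : Pv ≠ []),
      IsPath Pu ∧ IsPath Pv ∧
      Pu.head hPu = u ∧ Pv.head hPv = v ∧
      ((Pu.getLast hPu = eVec d m ∧ Pv.getLast hPv = eVec d (-m)) ∨
        (Pu.getLast hPu = eVec d (-m) ∧ Pv.getLast hPv = eVec d m)) ∧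
      (∀ x ∈ Pu, x ≠ Pu.head hPu → x ≠ Pu.getLast hPu →
        norm1 x ≤ r - 1 ∧ m < norm1 x) ∧
      (∀ x ∈ Pv, x ≠ Pv.head hPv → x ≠ Pv.getLast hPv →
        norm1 x ≤ r - 1 ∧ m < norm1 x) ∧
      (∀ x ∈ Pu, ∀ y ∈ Pv, x ≠ y ∧ ¬ _root_.Adj x y) := by
  have he : ∀ c, (Pi.single z c : Fin d → ℤ) = eVec d c := by
    intro c
    funext j
    by_cases hj : j = z
    · subst hj; simp [eVec, hz]
    · have : (j : ℕ) ≠ 0 := fun h0 => hj (Fin.ext (by omega))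
      simp [eVec, hj, this]
  obtain ⟨S, T, c, h1, h2, h3, h4, h5, h6, h7, h8⟩ := h
  obtain ⟨Pu, hPu, a1, a2, a3, a4⟩ := h4.toList h2
  obtain ⟨Pv, hPv, b1, b2, b3, b4⟩ := h5.toList h3
  refine ⟨Pu, Pv, hPu, hPv, a1, b1, a2, b2, ?_, ?_, ?_, ?_⟩
  · rw [a3, b3]
    simp only [he]
    rcases h1 with rfl | rfl
    · exact Or.inl ⟨rfl, rfl⟩
    · right; simp
  · intro x hx n1 n2
    rw [a2] at n1; rw [a3] at n2
    have := h6 x (a4 x hx)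
    tauto
  · intro x hx n1 n2
    rw [b2] at n1; rw [b3] at n2
    have := h7 x (b4 x hx)
    tauto
  · intro x hx y hy
    have := h8 x (a4 x hx) y (b4 y hy)
    constructor
    · rintro rfl
      simp [norm1] at this
    · intro h
      unfold _root_.Adj at h
      omega

theorem sep_coord {x y : Fin d → ℤ} (i : Fin d) (h : y i + 2 ≤ x i ∨ x i + 2 ≤ y i) :
    2 ≤ norm1 (x - y) := by
  have := abs_le_norm1 (x - y) i
  simp only [Pi.sub_apply] at this
  have h1 := le_abs_self (x i - y i)
  have h2 := neg_le_abs (x i - y i)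
  omega

theorem norm1_two {i j : Fin d} (hij : i ≠ j) (a b : ℤ) :
    norm1 (Function.update (Pi.single i a : Fin d → ℤ) j b) = |a| + |b| := by
  rw [norm1_update, norm1_single]
  simp [hij.symm]

/-- The separating coordinate is the first one. -/
theorem caseFirst (hd : 2 ≤ d) (z : Fin d) (m r s : ℤ) (hm : 1 ≤ m) (hr : m + 10 ≤ r)
    (u v : Fin d → ℤ) (hu : norm1 u = r) (hv : norm1 v = r) (hs0 : 0 ≤ s) (hs : s ≤ r - 5)
    (h1 : s < u z) (h2 : v z < s) : Good z m r u v := by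
  have hrr : |r - 1| = r - 1 := abs_of_nonneg (by omega)
  have hrr' : |-(r - 1)| = r - 1 := by rw [abs_neg, hrr]
  have absz : ∀ q : Fin d → ℤ, |q z| = q z ∧ 0 ≤ q z ∨ |q z| = - q z ∧ q z ≤ 0 := by
    intro q
    rcases abs_cases (q z) with h | h
    · left; omega
    · right; omega
  refine ⟨{q | (s + 1 ≤ q z ∧ (q = u ∨ (norm1 q ≤ r - 1 ∧ m < norm1 q))) ∨
      (q = Pi.single z (q z) ∧ norm1 q = |q z| ∧ m ≤ q z ∧ q z ≤ r - 1)},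
    {q | q z ≤ s - 1 ∧ (q z ≤ -1 ∨ 2 ≤ norm1 q - |q z|) ∧
      (q = v ∨ q = Pi.single z (-m) ∨ (norm1 q ≤ r - 1 ∧ m < norm1 q))}, m, Or.inl rfl,
    ?_, ?_, ?_, ?_, ?_, ?_, ?_⟩
  · exact Or.inl ⟨by omega, Or.inl rfl⟩
  · refine ⟨by omega, ?_, Or.inl rfl⟩
    have := absz v
    omega
  · refine Reach.trans ((pole r u (Or.inl hu) z (r - 1) hrr (by omega)).mono ?_)
      ((axis z (r - 1) m (by omega)).mono ?_)
    · rintro q ⟨a, -, b, c⟩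
      left
      refine ⟨by unfold Btw at a; omega, ?_⟩
      rcases b with b | b
      · exact Or.inl b
      · right; omega
    · rintro q ⟨a, b, c⟩
      right
      exact ⟨a, b, by unfold Btw at c; omega⟩
  · have key : ∀ p : Fin d → ℤ, (norm1 p = r ∨ norm1 p = r - 1) → (p = v ∨ norm1 p ≤ r - 1) →
        p z ≤ s - 1 → p z ≤ 0 →
        Reach {q | q z ≤ s - 1 ∧ (q z ≤ -1 ∨ 2 ≤ norm1 q - |q z|) ∧
          (q = v ∨ q = Pi.single z (-m) ∨ (norm1 q ≤ r - 1 ∧ m < norm1 q))} p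
          (Pi.single z (-m)) := by
      intro p hp hp' hps hp0
      refine Reach.trans ((pole r p hp z (-(r - 1)) hrr' (by omega)).mono ?_)
        ((axis z (-(r - 1)) (-m) (by omega)).mono ?_)
      · rintro q ⟨a, -, b, c⟩
        have := absz q
        unfold Btw at a
        refine ⟨by omega, by omega, ?_⟩
        rcases b with rfl | b
        · rcases hp' with h | h
          · exact Or.inl h
          · right; right; omega
        · right; right; omega
      · rintro q ⟨a, b, c⟩
        unfold Btw at c
        refine ⟨by omega, by omega, ?_⟩
        have := absz q
        by_cases hq : q z = -m
        · right; left; rw [a, hq]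
        · right; right; omega
    by_cases hv0 : v z ≤ 0
    · exact key v (Or.inl hv) (Or.inl rfl) (by omega) hv0
    · obtain ⟨j, hj⟩ : ∃ j : Fin d, j ≠ z := by
        haveI : Nontrivial (Fin d) := Fin.nontrivial_iff_two_le.2 hd
        exact exists_ne z
      obtain ⟨c, hc, hcs⟩ : ∃ c : ℤ, |c| = r - 1 ∧ ((0 ≤ v j ∧ 0 ≤ c) ∨ (v j ≤ 0 ∧ c ≤ 0)) := by
        by_cases hvj : 0 ≤ v j
        · exact ⟨r - 1, hrr, by omega⟩
        · exact ⟨-(r - 1), hrr', by omega⟩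
      have hn : norm1 (Pi.single j c : Fin d → ℤ) = r - 1 := by rw [norm1_single, hc]
      have hjz : (Pi.single j c : Fin d → ℤ) z = 0 := by simp [hj.symm]
      refine Reach.trans ((pole r v (Or.inl hv) j c hc hcs).mono ?_)
        (key (Pi.single j c) (Or.inr hn) (Or.inr (by omega)) (by omega) (by omega))
      rintro q ⟨-, a, b, c⟩
      have a' := a z hj.symm
      have := absz q
      unfold Btw at a'
      refine ⟨by omega, by omega, ?_⟩
      rcases b with b | b
      · exact Or.inl b
      · right; right; omega
  · rintro q (⟨-, h | h⟩ | ⟨a, b, c⟩)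
    · exact Or.inl h
    · exact Or.inr (Or.inr h)
    · have := absz q
      by_cases hq : q z = m
      · right; left; rw [a, hq]
      · right; right; omega
  · rintro q ⟨-, -, h⟩
    exact h
  · rintro x (⟨hx, -⟩ | ⟨a, b, c⟩) y ⟨hy1, hy2, hy3⟩
    · exact sep_coord z (by omega)
    · rcases hy2 with hy2 | hy2
      · exact sep_coord z (by omega)
      · rw [a, norm1_single_sub]
        have := abs_nonneg (x z - y z)
        omega

/-- The separating coordinate is not the first one, the separating value is positive. -/
theorem casePos (z i : Fin d) (hi : i ≠ z) (m r s : ℤ) (hm : 1 ≤ m) (hr : m + 10 ≤ r)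
    (u v : Fin d → ℤ) (hu : norm1 u = r) (hv : norm1 v = r) (hs0 : 1 ≤ s) (hs : s ≤ r - 5)
    (h1 : s < u i) (h2 : v i < s) (hvz : 0 ≤ v z) : Good z m r u v := by
  have hrr : |r - 1| = r - 1 := abs_of_nonneg (by omega)
  have hrr' : |-(r - 1)| = r - 1 := by rw [abs_neg, hrr]
  have absz : ∀ q : Fin d → ℤ, |q z| = q z ∧ 0 ≤ q z ∨ |q z| = - q z ∧ q z ≤ 0 := by
    intro q
    rcases abs_cases (q z) with h | h
    · left; omega
    · right; omega
  refine ⟨{q | ((s + 1 ≤ q i ∨ q z ≤ -2) ∧ (q = u ∨ (norm1 q ≤ r - 1 ∧ m < norm1 q))) ∨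
      q = Pi.single z (-m)},
    {q | q i ≤ s - 1 ∧ 0 ≤ q z ∧ m ≤ norm1 q ∧
      (q = v ∨ q = Pi.single z m ∨ (norm1 q ≤ r - 1 ∧ m < norm1 q))}, -m, Or.inr rfl,
    ?_, ?_, ?_, ?_, ?_, ?_, ?_⟩
  · exact Or.inl ⟨by omega, Or.inl rfl⟩
  · exact ⟨by omega, hvz, by omega, Or.inl rfl⟩
  · -- three stages and the axis
    set w : Fin d → ℤ := Function.update (Pi.single i (r - 3)) z (-2) with hw
    have hwn : norm1 w = r - 1 := by
      rw [hw, norm1_two hi, abs_of_nonneg (by omega)]; norm_num; ring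
    have hwz : w z = -2 := by simp [hw]
    have hwi : w i = r - 3 := by simp [hw, hi]
    have st1 := pole r u (Or.inl hu) i (r - 1) hrr (by omega)
    have hc : Compat (Pi.single i (r - 1)) w := by
      intro j
      by_cases hj : j = z
      · subst hj; rw [hwz]; simp [hi.symm]
      · by_cases hji : j = i
        · subst hji; rw [hwi]; simp; omega
        · simp [hw, hj, hji]
    have st2 := L _ _ hc
    have st3 := pole r w (Or.inr hwn) z (-(r - 1)) hrr' (by omega)
    have st4 := axis z (-(r - 1)) (-m) (by omega)
    refine (st1.mono ?_).trans ((st2.mono ?_).trans ((st3.mono ?_).trans (st4.mono ?_)))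
    · rintro q ⟨a, -, b, c⟩
      unfold Btw at a
      left
      refine ⟨by omega, ?_⟩
      rcases b with b | b
      · exact Or.inl b
      · right; omega
    · rintro q ⟨a, b, c⟩
      have a' := a i
      rw [hwi] at a'
      simp [Btw] at a'
      left
      rw [hwn, norm1_single, hrr] at b c
      refine ⟨by omega, Or.inr ?_⟩
      rcases b with rfl | b
      · rw [norm1_single, hrr]; omega
      · omega
    · rintro q ⟨a, -, b, c⟩
      unfold Btw at a
      left
      refine ⟨by omega, Or.inr ?_⟩
      rcases b with rfl | b
      · omega
      · omega
    · rintro q ⟨a, b, c⟩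
      unfold Btw at c
      have := absz q
      by_cases hq : q z = -m
      · right; change q = _; rw [a, hq]
      · left; exact ⟨by omega, Or.inr (by omega)⟩
  · rw [neg_neg]
    refine Reach.trans ((pole r v (Or.inl hv) z (r - 1) hrr (by omega)).mono ?_)
      ((axis z (r - 1) m (by omega)).mono ?_)
    · rintro q ⟨a, a2, b, c⟩
      have a3 := a2 i hi
      unfold Btw at a a3
      refine ⟨by omega, by omega, by omega, ?_⟩
      rcases b with b | b
      · exact Or.inl b
      · right; right; omega
    · rintro q ⟨a, b, c⟩
      unfold Btw at c
      have := absz q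
      have hqi : q i = 0 := by rw [a]; simp [hi]
      refine ⟨by omega, by omega, by omega, ?_⟩
      by_cases hq : q z = m
      · right; left; rw [a, hq]
      · right; right; omega
  · rintro q (⟨-, h | h⟩ | h)
    · exact Or.inl h
    · exact Or.inr (Or.inr h)
    · exact Or.inr (Or.inl h)
  · rintro q ⟨-, -, -, h⟩
    rw [neg_neg]
    exact h
  · rintro x (⟨hx | hx, -⟩ | hx) y ⟨hy1, hy2, hy3, hy4⟩
    · exact sep_coord i (by omega)
    · exact sep_coord z (by omega)
    · rw [hx, norm1_single_sub]
      have := neg_le_abs (-m - y z)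
      rw [abs_of_nonneg hy2]
      omega

def HSet (z i : Fin d) (m r : ℤ) (u : Fin d → ℤ) : Set (Fin d → ℤ) :=
  {q | (1 ≤ q i ∧ (q z ≤ 0 ∨ m + 2 ≤ norm1 q) ∧ (q = u ∨ (norm1 q ≤ r - 1 ∧ m < norm1 q))) ∨
      q = Pi.single z (-m)}

theorem reachH (z i : Fin d) (hi : i ≠ z) (m r : ℤ) (hm : 1 ≤ m) (hr : m + 10 ≤ r)
    (u : Fin d → ℤ) (hu : norm1 u = r) (h1 : 0 < u i) :
    Reach (HSet z i m r u) u (Pi.single z (-m)) := by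
  have hrr : |r - 1| = r - 1 := abs_of_nonneg (by omega)
  have absi : ∀ q : Fin d → ℤ, |q i| = q i ∧ 0 ≤ q i ∨ |q i| = - q i ∧ q i ≤ 0 := by
    intro q
    rcases abs_cases (q i) with h | h
    · left; omega
    · right; omega
  set w : Fin d → ℤ := Function.update (Pi.single i 1) z (-(m + 1)) with hw
  set w' : Fin d → ℤ := Function.update (Pi.single i 1) z (-m) with hw'
  have hwn : norm1 w = m + 2 := by
    rw [hw, norm1_two hi, abs_neg, abs_of_nonneg (a := m + 1) (by omega)]; norm_num; ring
  have hwn' : norm1 w' = m + 1 := by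
    rw [hw', norm1_two hi, abs_neg, abs_of_nonneg (a := m) (by omega)]; norm_num; ring
  have hwz : w z = -(m + 1) := by simp [hw]
  have hwi : w i = 1 := by simp [hw, hi]
  have hwz' : w' z = -m := by simp [hw']
  have hwi' : w' i = 1 := by simp [hw', hi]
  have hc : Compat (Pi.single i (m + 2)) w := by
    intro j
    by_cases hj : j = z
    · subst hj; rw [hwz]; simp [hi.symm]; omega
    · by_cases hji : j = i
      · subst hji; rw [hwi]; simp; omega
      · simp [hw, hj, hji]
  have e1 : w' = Function.update w z (-m) := by simp [hw, hw']
  have e2 : (Pi.single z (-m) : Fin d → ℤ) = Function.update w' i 0 := by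
    funext j
    by_cases hj : j = z
    · subst hj; simp [hw', hi.symm]
    · by_cases hji : j = i
      · subst hji; simp [hi]
      · simp [hw', hj, hji]
  have st1 := pole r u (Or.inl hu) i (r - 1) hrr (by omega)
  have st2 := axis i (r - 1) (m + 2) (by omega)
  have st3 := L _ _ hc
  have mw : w ∈ HSet z i m r u := Or.inl ⟨by omega, by omega, Or.inr (by omega)⟩
  have mw' : w' ∈ HSet z i m r u := Or.inl ⟨by omega, by omega, Or.inr (by omega)⟩
  have st4 : Reach (HSet z i m r u) w w' := by
    refine Reach.step ?_ mw mw'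
    rw [e1]
    apply adj_update
    rw [hwz]; norm_num
  have st5 : Reach (HSet z i m r u) w' (Pi.single z (-m)) := by
    refine Reach.step ?_ mw' (Or.inr rfl)
    rw [e2]
    apply adj_update
    rw [hwi']; norm_num
  refine (st1.mono ?_).trans ((st2.mono ?_).trans ((st3.mono ?_).trans (st4.trans st5)))
  · rintro q ⟨a, -, b, c⟩
    unfold Btw at a
    left
    refine ⟨by omega, by omega, ?_⟩
    rcases b with b | b
    · exact Or.inl b
    · right; omega
  · rintro q ⟨a, b, c⟩
    unfold Btw at c
    have := absi q
    have hqz : q z = 0 := by rw [a]; simp [hi.symm]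
    left
    exact ⟨by omega, by omega, Or.inr (by omega)⟩
  · rintro q ⟨a, b, c⟩
    have a' := a i
    have a2 := a z
    rw [hwi] at a'
    rw [hwz] at a2
    simp [Btw, hi.symm] at a' a2
    have hmm : |m + 2| = m + 2 := abs_of_nonneg (by omega)
    rw [hwn, norm1_single, hmm] at b c
    left
    refine ⟨by omega, by omega, Or.inr ?_⟩
    rcases b with rfl | b
    · rw [norm1_single, hmm]; omega
    · omega

/-- The separating coordinate is not the first one, the separating value is zero. -/
theorem caseZero (z i : Fin d) (hi : i ≠ z) (m r : ℤ) (hm : 1 ≤ m) (hr : m + 10 ≤ r)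
    (u v : Fin d → ℤ) (hu : norm1 u = r) (hv : norm1 v = r)
    (h1 : 0 < u i) (h2 : v i < 0) : Good z m r u v := by
  have hneg : ∀ c : ℤ, -(Pi.single z c : Fin d → ℤ) = Pi.single z (-c) := fun c => by
    rw [Pi.single_neg]
  have shell : ∀ (u : Fin d → ℤ), ∀ x ∈ HSet z i m r u,
      x = u ∨ x = Pi.single z (-m) ∨ (norm1 x ≤ r - 1 ∧ m < norm1 x) := by
    rintro u q (⟨-, -, h | h⟩ | h)
    · exact Or.inl h
    · exact Or.inr (Or.inr h)
    · exact Or.inr (Or.inl h)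
  have far : ∀ q : Fin d → ℤ, 1 ≤ norm1 q → (q z ≤ 0 ∨ m + 2 ≤ norm1 q) →
      2 ≤ norm1 ((Pi.single z m : Fin d → ℤ) - q) := by
    intro q h0 h
    rw [norm1_single_sub]
    have b1 := le_abs_self (m - q z)
    have b2 := neg_le_abs (m - q z)
    rcases abs_cases (q z) with h' | h' <;> omega
  refine ⟨HSet z i m r u, {q | -q ∈ HSet z i m r (-v)}, -m, Or.inr rfl, ?_, ?_, ?_, ?_, ?_, ?_, ?_⟩
  · exact Or.inl ⟨by omega, by omega, Or.inl rfl⟩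
  · refine Or.inl ⟨by simp; omega, by rw [norm1_neg]; omega, Or.inl rfl⟩
  · exact reachH z i hi m r hm hr u hu h1
  · have := reachH z i hi m r hm hr (-v) (by rw [norm1_neg]; exact hv) (by simp; omega)
    have := Reach.map (T := {q | -q ∈ HSet z i m r (-v)}) (fun x => -x)
      (fun a b => by rw [← norm1_neg]; congr 1; ring) (fun x hx => by simpa using hx) this
    simpa only [neg_neg, hneg] using this
  · exact shell u
  · intro x hx
    rcases shell _ _ hx with h | h | h
    · left; exact neg_injective h
    · right; left; rw [← neg_neg x, h, hneg]
    · right; right; rwa [norm1_neg] at h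
  · have key : ∀ x : Fin d → ℤ, 1 ≤ x i → 1 ≤ norm1 x := fun x hx => by
      have := abs_le_norm1 x i
      have := le_abs_self (x i)
      omega
    rintro x (⟨hx1, hx2, -⟩ | hx) y (⟨hy1, hy2, -⟩ | hy)
    · simp at hy1
      exact sep_coord i (by omega)
    · have hy' : y = Pi.single z m := by rw [← neg_neg y, hy, hneg, neg_neg]
      rw [hy', norm1_sub_comm]
      exact far x (key x hx1) hx2
    · have := far (-y) (key _ hy1) hy2
      rw [hx]
      rw [← norm1_neg] at this
      convert this using 2
      rw [← hneg]; ring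
    · have hy' : y = Pi.single z m := by rw [← neg_neg y, hy, hneg, neg_neg]
      apply sep_coord z
      rw [hx, hy']
      simp
      omega

theorem good_pos (hd : 2 ≤ d) (z : Fin d) (m r : ℤ) (hm : 1 ≤ m) (hr : m + 10 ≤ r)
    (u v : Fin d → ℤ) (hu : norm1 u = r) (hv : norm1 v = r) (i : Fin d) (s : ℤ) (hs0 : 0 ≤ s)
    (hs : s ≤ r - 5) (h1 : s < u i) (h2 : v i < s) : Good z m r u v := by
  by_cases hi : i = z
  · subst hi
    exact caseFirst hd i m r s hm hr u v hu hv hs0 hs h1 h2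
  by_cases hs1 : s = 0
  · subst hs1
    exact caseZero z i hi m r hm hr u v hu hv h1 h2
  by_cases hvz : 0 ≤ v z
  · exact casePos z i hi m r s hm hr u v hu hv (by omega) hs h1 h2 hvz
  · have hε : ∀ j, Function.update (1 : Fin d → ℤ) z (-1) j = 1 ∨
        Function.update (1 : Fin d → ℤ) z (-1) j = -1 := by
      intro j
      by_cases hj : j = z
      · subst hj; simp
      · simp [hj]
    have hn : ∀ x : Fin d → ℤ, norm1 (Function.update (1 : Fin d → ℤ) z (-1) * x) = norm1 x := by
      intro x
      unfold norm1
      apply Finset.sum_congr rfl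
      intro j _
      rw [Pi.mul_apply]
      rcases hε j with h | h <;> rw [h] <;> simp
    apply Good.refl_signs _ hε
    refine casePos z i hi m r s hm hr _ _ (by rw [hn, hu]) (by rw [hn, hv]) (by omega) hs ?_ ?_ ?_
    · simpa [hi] using h1
    · simpa [hi] using h2
    · simp; omega

theorem good_all (hd : 2 ≤ d) (z : Fin d) (m r : ℤ) (hm : 1 ≤ m) (hr : m + 10 ≤ r)
    (u v : Fin d → ℤ) (hu : norm1 u = r) (hv : norm1 v = r) (i : Fin d) (s : ℤ)
    (hs : |s| ≤ r - 5) (h1 : s < u i) (h2 : v i < s) : Good z m r u v := by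
  have hs' := abs_le.1 hs
  by_cases hs0 : 0 ≤ s
  · exact good_pos hd z m r hm hr u v hu hv i s hs0 (by omega) h1 h2
  · apply Good.refl_signs (-1) (fun j => by simp)
    apply Good.symm
    refine good_pos hd z m r hm hr _ _ ?_ ?_ i (-s) (by omega) (by omega) ?_ ?_
    · rw [neg_one_mul, norm1_neg, hv]
    · rw [neg_one_mul, norm1_neg, hu]
    · simp; omega
    · simp; omega

end S5

theorem statement5 (d : ℕ) (hd : 2 ≤ d) (m r : ℤ) (hm : 1 ≤ m) (hr : m + 10 ≤ r)
    (u v : Fin d → ℤ) (hu : norm1 u = r) (hv : norm1 v = r)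
    (hsep : ∃ (i : Fin d) (s : ℤ), |s| ≤ r - 5 ∧
      ((u i > s ∧ s > v i) ∨ (v i > s ∧ s > u i))) :
    ∃ (Pu Pv : List (Fin d → ℤ)) (hPu : Pu ≠ []) (hPv : Pv ≠ []),
      IsPath Pu ∧ IsPath Pv ∧
      Pu.head hPu = u ∧ Pv.head hPv = v ∧
      ((Pu.getLast hPu = eVec d m ∧ Pv.getLast hPv = eVec d (-m)) ∨
        (Pu.getLast hPu = eVec d (-m) ∧ Pv.getLast hPv = eVec d m)) ∧
      (∀ x ∈ Pu, x ≠ Pu.head hPu → x ≠ Pu.getLast hPu →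
        norm1 x ≤ r - 1 ∧ m < norm1 x) ∧
      (∀ x ∈ Pv, x ≠ Pv.head hPv → x ≠ Pv.getLast hPv →
        norm1 x ≤ r - 1 ∧ m < norm1 x) ∧
      (∀ x ∈ Pu, ∀ y ∈ Pv, x ≠ y ∧ ¬ Adj x y) := by
  obtain ⟨i, s, hs, h | h⟩ := hsep
  · exact S5.Good.final (z := ⟨0, by omega⟩) rfl
      (S5.good_all hd _ m r hm hr u v hu hv i s hs h.1 h.2)
  · exact S5.Good.final (z := ⟨0, by omega⟩) rfl
      (S5.good_all hd _ m r hm hr v u hv hu i s hs h.1 h.2).symm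
end
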